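/- arXiv:2205.15637 — 4 statements merged into one kernel-verified Lean document; each statement's English description precedes it below -/
import Mathlib

section
/- Define σ_r : T × G → T by t · g := λ(Φ(t) · A([g])) · t₁. Then σ_r is a well-defined transitive right action of G on T, it does not depend on the choice of the section λ, the right stabilizer {g ∈ G : t · g = t} equals H for every t ∈ T, and σ_r is compatible with the given left action in the sense that g · (t · g') = (g · t) · g' for all g, g' ∈ G and t ∈ T. -/
/-- The candidate right action `σ_r(t, g) = λ(Φ(t) · A([g])) · t₁`. -/
noncomputable def sigmaR {G T : Type*} [Group G] [MulAction G T]
    (t₁ : T) [(MulAction.stabilizer G t₁).Normal]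
    (A : (G ⧸ MulAction.stabilizer G t₁) ≃* (G ⧸ MulAction.stabilizer G t₁))
    (Φ : T → G ⧸ MulAction.stabilizer G t₁)
    (lam : (G ⧸ MulAction.stabilizer G t₁) → G)
    (t : T) (g : G) : T :=
  lam (Φ t * A (QuotientGroup.mk g)) • t₁

theorem smul_eq_smul_iff_mk_stabilizer_eq {G T : Type*} [Group G] [MulAction G T] (t₁ : T)
    (a b : G) :
    a • t₁ = b • t₁ ↔
      (QuotientGroup.mk a : G ⧸ MulAction.stabilizer G t₁) = QuotientGroup.mk b := by
  rw [QuotientGroup.eq, MulAction.mem_stabilizer_iff, mul_smul, inv_smul_eq_iff, eq_comm]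

/-- If `b` represents `A [g]`, then `g` acts on the right by `a • t₁ ↦ (a * b) • t₁`. -/
theorem sigmaR_smul_base {G T : Type*} [Group G] [MulAction G T]
    (t₁ : T) [(MulAction.stabilizer G t₁).Normal]
    (A : (G ⧸ MulAction.stabilizer G t₁) ≃* (G ⧸ MulAction.stabilizer G t₁))
    (Φ : T → G ⧸ MulAction.stabilizer G t₁)
    (hΦ : ∀ g : G, Φ (g • t₁) = QuotientGroup.mk g)
    (lam : (G ⧸ MulAction.stabilizer G t₁) → G)
    (hlam : ∀ x, QuotientGroup.mk (lam x) = x)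
    (a b g : G) (hb : A (QuotientGroup.mk g) = QuotientGroup.mk b) :
    sigmaR t₁ A Φ lam (a • t₁) g = (a * b) • t₁ := by
  rw [sigmaR, smul_eq_smul_iff_mk_stabilizer_eq, hlam, hΦ, hb, QuotientGroup.mk_mul]

/-- `σ_r` is a well-defined transitive right action of `G` on `T`,
independent of the chosen section `λ`, with right stabilizer `H = Stab(t₁)` at
every point, compatible with the given left action. -/
theorem sigmaR_right_action {G T : Type*} [Group G] [Fintype G] [Fintype T]
    [MulAction G T] (t₁ : T) [(MulAction.stabilizer G t₁).Normal]
    (htrans : ∀ t : T, ∃ g : G, g • t₁ = t)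
    (gt : G)
    (A : (G ⧸ MulAction.stabilizer G t₁) ≃* (G ⧸ MulAction.stabilizer G t₁))
    (hA2 : ∀ g : G, A (A (QuotientGroup.mk g)) = QuotientGroup.mk (gt⁻¹ * g * gt))
    (hAg : A (QuotientGroup.mk gt) = QuotientGroup.mk gt)
    (Φ : T → G ⧸ MulAction.stabilizer G t₁)
    (hΦ : ∀ g : G, Φ (g • t₁) = QuotientGroup.mk g)
    (lam : (G ⧸ MulAction.stabilizer G t₁) → G)
    (hlam : ∀ x, QuotientGroup.mk (lam x) = x) :
    -- σ_r depends only on the class of g (well-definedness in g)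
    (∀ (t : T) (g g' : G), (QuotientGroup.mk g : G ⧸ MulAction.stabilizer G t₁) =
        QuotientGroup.mk g' → sigmaR t₁ A Φ lam t g = sigmaR t₁ A Φ lam t g') ∧
    -- σ_r does not depend on the choice of the section λ
    (∀ lam' : (G ⧸ MulAction.stabilizer G t₁) → G,
        (∀ x, QuotientGroup.mk (lam' x) = x) →
        sigmaR t₁ A Φ lam = sigmaR t₁ A Φ lam') ∧
    -- σ_r is a right action
    (∀ t : T, sigmaR t₁ A Φ lam t 1 = t) ∧
    (∀ (t : T) (g g' : G),
        sigmaR t₁ A Φ lam (sigmaR t₁ A Φ lam t g) g' = sigmaR t₁ A Φ lam t (g * g')) ∧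
    -- σ_r is transitive
    (∀ t t' : T, ∃ g : G, sigmaR t₁ A Φ lam t g = t') ∧
    -- the right stabilizer of every t equals H
    (∀ (t : T) (g : G), sigmaR t₁ A Φ lam t g = t ↔ g ∈ MulAction.stabilizer G t₁) ∧
    -- compatibility with the left action
    (∀ (g g' : G) (t : T), g • sigmaR t₁ A Φ lam t g' = sigmaR t₁ A Φ lam (g • t) g') := by
  have key := sigmaR_smul_base t₁ A Φ hΦ lam hlam
  have rep : ∀ g : G, ∃ b : G, A (QuotientGroup.mk g) = QuotientGroup.mk b := fun g =>
    ⟨lam (A (QuotientGroup.mk g)), (hlam _).symm⟩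
  refine ⟨?_, ?_, ?_, ?_, ?_, ?_, ?_⟩
  · intro t g g' h
    rw [sigmaR, sigmaR, h]
  · intro lam' hlam'
    funext t g
    rw [sigmaR, sigmaR, smul_eq_smul_iff_mk_stabilizer_eq, hlam, hlam']
  · intro t
    obtain ⟨a, rfl⟩ := htrans t
    rw [key a 1 1 (by rw [QuotientGroup.mk_one, map_one]), mul_one]
  · intro t g g'
    obtain ⟨a, rfl⟩ := htrans t
    obtain ⟨b, hb⟩ := rep g
    obtain ⟨b', hb'⟩ := rep g'
    rw [key a b g hb, key (a * b) b' g' hb', key a (b * b') (g * g')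
      (by rw [QuotientGroup.mk_mul, map_mul, hb, hb', QuotientGroup.mk_mul]), mul_assoc]
  · intro t t'
    obtain ⟨a, rfl⟩ := htrans t
    obtain ⟨c, rfl⟩ := htrans t'
    refine ⟨lam (A.symm (QuotientGroup.mk (a⁻¹ * c))), ?_⟩
    rw [key a (a⁻¹ * c) _ (by rw [hlam, A.apply_symm_apply]), mul_inv_cancel_left]
  · intro t g
    obtain ⟨a, rfl⟩ := htrans t
    obtain ⟨b, hb⟩ := rep g
    rw [key a b g hb, mul_smul, smul_left_cancel_iff, ← MulAction.mem_stabilizer_iff,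
      ← QuotientGroup.eq_one_iff, ← hb, EmbeddingLike.map_eq_one_iff, QuotientGroup.eq_one_iff]
  · intro g g' t
    obtain ⟨a, rfl⟩ := htrans t
    obtain ⟨b, hb⟩ := rep g'
    rw [key a b g' hb, ← mul_smul, ← mul_smul, key (g * a) b g' hb, mul_assoc]
end

section
/- Let B = G ⊔ T (disjoint union) and define structure constants N on B as follows: for g, g', k ∈ G, N_{g g'}^k = 1 if gg' = k and 0 otherwise, and N_{g g'}^t = 0 for t ∈ T; N_{g t}^τ = 1 if τ = g·t and 0 otherwise, and N_{g t}^h = 0 for h ∈ G; N_{t g}^τ = 1 if τ = λ(Φ(t)·A([g]))·t₁ and 0 otherwise, and N_{t g}^h = 0 for h ∈ G; for t, t' ∈ T, N_{t t'}^g = 1 if g ∈ λ(Φ(t)·A(Φ(t'))) g̃⁻¹ H and 0 otherwise (g ∈ G), and N_{t t'}^τ = n for every τ ∈ T. Then B with unit 1 ∈ G, these structure constants, and the involution given by ḡ = g⁻¹ on G and t̄ = σ_r(g̃·t₁, λ(Φ(t))⁻¹) on T is a fusion ring, and this fusion ring is independent of the particular choice of the section λ. -/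
/-- A fusion ring, given by its finite basis `B`, unit, involution (dual) and
structure constants `N a b c` (the coefficient of `c` in `a × b`). -/
structure FusionData (B : Type*) [Fintype B] [DecidableEq B] where
  one : B
  dual : B → B
  N : B → B → B → ℕ
  dual_dual : ∀ a, dual (dual a) = a
  N_one_left : ∀ a c, N one a c = if a = c then 1 else 0
  N_one_right : ∀ a c, N a one c = if a = c then 1 else 0
  assoc : ∀ a b c d, ∑ e, N a b e * N e c d = ∑ f, N b c f * N a f d
  dual_pair : ∀ a b, N a (dual b) one = if a = b then 1 else 0
  frob : ∀ a b c, N a b c = N (dual a) c b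

open scoped Classical in
/-- The structure constants of the song extension `[H ⊴ G]^A_{g̃|n}` on `G ⊔ T`. -/
noncomputable def songN {G T : Type*} [Group G] [MulAction G T]
    (t₁ : T) [(MulAction.stabilizer G t₁).Normal]
    (gt : G)
    (A : (G ⧸ MulAction.stabilizer G t₁) ≃* (G ⧸ MulAction.stabilizer G t₁))
    (Φ : T → G ⧸ MulAction.stabilizer G t₁)
    (lam : (G ⧸ MulAction.stabilizer G t₁) → G)
    (n : ℕ) : (G ⊕ T) → (G ⊕ T) → (G ⊕ T) → ℕ
  | Sum.inl g, Sum.inl g', Sum.inl k => if g * g' = k then 1 else 0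
  | Sum.inl _, Sum.inl _, Sum.inr _ => 0
  | Sum.inl g, Sum.inr t, Sum.inr τ => if τ = g • t then 1 else 0
  | Sum.inl _, Sum.inr _, Sum.inl _ => 0
  | Sum.inr t, Sum.inl g, Sum.inr τ =>
      if τ = lam (Φ t * A (QuotientGroup.mk g)) • t₁ then 1 else 0
  | Sum.inr _, Sum.inl _, Sum.inl _ => 0
  | Sum.inr t, Sum.inr t', Sum.inl g =>
      -- `g ∈ λ(Φ(t)·A(Φ(t'))) g̃⁻¹ H`
      if (lam (Φ t * A (Φ t')) * gt⁻¹)⁻¹ * g ∈ MulAction.stabilizer G t₁ then 1 else 0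
  | Sum.inr _, Sum.inr _, Sum.inr _ => n

/-- The involution of the song extension: `ḡ = g⁻¹` and `t̄ = σ_r(g̃·t₁, λ(Φ(t))⁻¹)`. -/
noncomputable def songDual {G T : Type*} [Group G] [MulAction G T]
    (t₁ : T) [(MulAction.stabilizer G t₁).Normal]
    (gt : G)
    (A : (G ⧸ MulAction.stabilizer G t₁) ≃* (G ⧸ MulAction.stabilizer G t₁))
    (Φ : T → G ⧸ MulAction.stabilizer G t₁)
    (lam : (G ⧸ MulAction.stabilizer G t₁) → G) : (G ⊕ T) → (G ⊕ T)
  | Sum.inl g => Sum.inl g⁻¹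
  | Sum.inr t => Sum.inr (lam (Φ (gt • t₁) * A (QuotientGroup.mk (lam (Φ t))⁻¹)) • t₁)

section CosetFusion

variable {G T Q : Type*} [Group G] [Group Q]

open scoped Classical in
/-- The structure constants of a song extension, with the `G`-set `T` replaced by a set in
bijection `p` with the group `Q`, over which `G` lies via `q`. -/
noncomputable def cosetN (q : G →* Q) (p : T ≃ Q) (A : Q ≃* Q) (c : Q) (n : ℕ) :
    (G ⊕ T) → (G ⊕ T) → (G ⊕ T) → ℕ
  | Sum.inl g, Sum.inl g', Sum.inl k => if k = g * g' then 1 else 0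
  | Sum.inl _, Sum.inl _, Sum.inr _ => 0
  | Sum.inl g, Sum.inr t, Sum.inr τ => if τ = p.symm (q g * p t) then 1 else 0
  | Sum.inl _, Sum.inr _, Sum.inl _ => 0
  | Sum.inr t, Sum.inl g, Sum.inr τ => if τ = p.symm (p t * A (q g)) then 1 else 0
  | Sum.inr _, Sum.inl _, Sum.inl _ => 0
  | Sum.inr t, Sum.inr t', Sum.inl g => if q g = p t * A (p t') * c⁻¹ then 1 else 0
  | Sum.inr _, Sum.inr _, Sum.inr _ => n

/-- The involution accompanying `cosetN`. -/
def cosetDual (p : T ≃ Q) (A : Q ≃* Q) (c : Q) : (G ⊕ T) → (G ⊕ T)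
  | Sum.inl g => Sum.inl g⁻¹
  | Sum.inr t => Sum.inr (p.symm (c * A (p t)⁻¹))

open scoped Classical in
/-- All fibers of a surjective homomorphism have the same size; hence two conditions that are
constant, with the same value, on two fibers hold equally often there. -/
theorem sum_fiber_ite_eq [Fintype G] {q : G →* Q} (hq : Function.Surjective q) {x y : Q}
    {φ ψ : G → Prop} (h : ∀ a b, q a = x → q b = y → (φ a ↔ ψ b)) :
    ∑ g, (if q g = x then if φ g then 1 else 0 else 0 : ℕ) =
      ∑ g, if q g = y then if ψ g then 1 else 0 else 0 := by
  obtain ⟨a, ha⟩ := hq (y * x⁻¹)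
  refine Fintype.sum_equiv (Equiv.mulLeft a) _ _ fun g => ?_
  have key : q (a * g) = y ↔ q g = x := by
    rw [map_mul, ha, mul_assoc, mul_eq_left, inv_mul_eq_one, eq_comm]
  by_cases hg : q g = x
  · rw [Equiv.coe_mulLeft, if_pos hg, if_pos (key.2 hg)]
    exact if_congr (h g _ hg (key.2 hg)) rfl rfl
  · simp [-map_mul, hg, key]

section

variable {q : G →* Q} {p : T ≃ Q} {A : Q ≃* Q} {c : Q}

theorem cosetDual_cosetDual (hA2 : ∀ x, A (A x) = c⁻¹ * x * c) (hAc : A c = c) (a : G ⊕ T) :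
    cosetDual p A c (cosetDual p A c a) = a := by
  rcases a with g | t <;> simp [cosetDual, hA2, hAc, mul_assoc]

theorem cosetN_frob (hA2 : ∀ x, A (A x) = c⁻¹ * x * c) (hAc : A c = c) (n : ℕ) (a b d : G ⊕ T) :
    cosetN q p A c n a b d = cosetN q p A c n (cosetDual p A c a) d b := by
  rcases a with g | t <;> rcases b with h | s <;> rcases d with k | u <;>
    simp only [cosetN, cosetDual] <;> classical refine if_congr ?_ rfl rfl
  · rw [eq_inv_mul_iff_mul_eq, eq_comm]
  · rw [Equiv.eq_symm_apply, Equiv.eq_symm_apply, map_inv, eq_inv_mul_iff_mul_eq, eq_comm]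
  · rw [Equiv.eq_symm_apply, Equiv.apply_symm_apply, ← A.injective.eq_iff, map_mul, hA2, map_inv,
      eq_mul_inv_iff_mul_eq, mul_assoc c, ← inv_mul_eq_iff_eq_mul, mul_assoc c⁻¹,
      eq_inv_mul_iff_mul_eq, eq_comm]
  · rw [Equiv.eq_symm_apply, Equiv.apply_symm_apply, ← A.injective.eq_iff (a := q k), map_mul,
      map_mul, hA2, map_inv A c, hAc, map_inv]
    simp only [mul_assoc, mul_inv_cancel, mul_one]
    rw [← inv_mul_eq_iff_eq_mul, eq_inv_mul_iff_mul_eq, eq_comm]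

theorem cosetN_assoc [Fintype G] [Fintype T] (hq : Function.Surjective q)
    (hA2 : ∀ x, A (A x) = c⁻¹ * x * c) (hAc : A c = c) (n : ℕ) (a b d e : G ⊕ T) :
    ∑ f, cosetN q p A c n a b f * cosetN q p A c n f d e =
      ∑ f, cosetN q p A c n b d f * cosetN q p A c n a f e := by
  classical
  rcases a with g | t <;> rcases b with h | s <;> rcases d with k | u <;> rcases e with l | v <;>
    simp only [Fintype.sum_sum_type, cosetN, ite_mul, one_mul, zero_mul, mul_zero,
      Finset.sum_const_zero, add_zero, zero_add, Finset.sum_ite_eq', Finset.mem_univ, if_true,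
      Equiv.apply_symm_apply, map_mul, hA2, mul_assoc]
  · rw [Fintype.sum_eq_single (g⁻¹ * l) fun x hx => ?_]
    · simp [inv_mul_eq_iff_eq_mul]
    · rw [if_neg (c := l = g * x) fun h => hx (eq_inv_mul_iff_mul_eq.2 h.symm), ite_self]
  · have (x : T) : v = p.symm (q g * p x) ↔ x = p.symm ((q g)⁻¹ * p v) := by
      rw [Equiv.eq_symm_apply, Equiv.eq_symm_apply, eq_inv_mul_iff_mul_eq, eq_comm]
    simp [this]
  · rw [Fintype.sum_eq_single (l * k⁻¹) fun x hx => ?_]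
    · simp [mul_inv_eq_iff_eq_mul, mul_assoc]
    · rw [if_neg (c := l = x * k) fun h => hx (eq_mul_inv_iff_mul_eq.2 h.symm), ite_self]
  · have (x : T) : v = p.symm (p x * A (q k)) ↔ x = p.symm (p v * (A (q k))⁻¹) := by
      rw [Equiv.eq_symm_apply, Equiv.eq_symm_apply, eq_mul_inv_iff_mul_eq, eq_comm]
    simp [this]
  · have h₁ (x : T) : q l = p x * (A (p u) * c⁻¹) ↔ x = p.symm (q l * (A (p u) * c⁻¹)⁻¹) := by
      rw [Equiv.eq_symm_apply, eq_mul_inv_iff_mul_eq, eq_comm]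
    have h₂ (x : T) : q l = p t * (A (p x) * c⁻¹) ↔ x = p.symm (A.symm ((p t)⁻¹ * q l * c)) := by
      rw [Equiv.eq_symm_apply, MulEquiv.eq_symm_apply, ← inv_mul_eq_iff_eq_mul,
        eq_mul_inv_iff_mul_eq, eq_comm]
    simp [h₁, h₂]
  · refine congrArg (· + _) (sum_fiber_ite_eq hq fun a b ha hb => ?_)
    rw [ha, hb]
    simp [hA2, hAc, mul_assoc]

end

/-- The fusion ring with structure constants `cosetN`. -/
noncomputable def cosetFusionData [Fintype G] [DecidableEq G] [Fintype T] [DecidableEq T]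
    {q : G →* Q} (hq : Function.Surjective q) (p : T ≃ Q) {A : Q ≃* Q} {c : Q}
    (hA2 : ∀ x, A (A x) = c⁻¹ * x * c) (hAc : A c = c) (n : ℕ) : FusionData (G ⊕ T) where
  one := Sum.inl 1
  dual := cosetDual p A c
  N := cosetN q p A c n
  dual_dual := cosetDual_cosetDual hA2 hAc
  N_one_left a b := by
    rcases a with g | t <;> rcases b with h | s <;> simp [cosetN, eq_comm]
  N_one_right a b := by
    rcases a with g | t <;> rcases b with h | s <;> simp [cosetN, eq_comm]
  assoc := cosetN_assoc hq hA2 hAc n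
  dual_pair a b := by
    rcases a with g | t <;> rcases b with h | s <;>
      simp [cosetN, cosetDual, hA2, hAc, mul_assoc, eq_mul_inv_iff_mul_eq, mul_inv_eq_one, eq_comm]
  frob := cosetN_frob hA2 hAc n

end CosetFusion

section Song

variable {G T : Type*} [Group G] [MulAction G T] {t₁ : T}
  {lam : (G ⧸ MulAction.stabilizer G t₁) → G}

theorem section_smul_eq {Φ : T ≃ G ⧸ MulAction.stabilizer G t₁}
    (hΦ : ∀ g : G, Φ (g • t₁) = QuotientGroup.mk g) (hlam : ∀ x, QuotientGroup.mk (lam x) = x)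
    (x : G ⧸ MulAction.stabilizer G t₁) : lam x • t₁ = Φ.symm x := by
  rw [Equiv.eq_symm_apply, hΦ, hlam]

variable [(MulAction.stabilizer G t₁).Normal] {gt : G}
  {A : (G ⧸ MulAction.stabilizer G t₁) ≃* (G ⧸ MulAction.stabilizer G t₁)}

theorem songN_eq_cosetN {Φ : T ≃ G ⧸ MulAction.stabilizer G t₁}
    (hΦ : ∀ g : G, Φ (g • t₁) = QuotientGroup.mk g) (hlam : ∀ x, QuotientGroup.mk (lam x) = x)
    (n : ℕ) :
    songN t₁ gt A Φ lam n =
      cosetN (QuotientGroup.mk' (MulAction.stabilizer G t₁)) Φ A (QuotientGroup.mk gt) n := by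
  funext a b d
  rcases a with g | t <;> rcases b with h | s <;> rcases d with k | u <;>
    simp only [songN, cosetN] <;> congr 1 <;> apply propext
  · exact eq_comm
  · have : g • s = Φ.symm (g * Φ s) := by
      rw [Equiv.eq_symm_apply]
      obtain ⟨x, hx⟩ := QuotientGroup.mk_surjective (Φ s)
      have hs : s = x • t₁ := Φ.injective (by rw [hΦ, hx])
      rw [hs, smul_smul, hΦ, hΦ, QuotientGroup.mk_mul]
    rw [this, QuotientGroup.mk'_apply]
  · rw [section_smul_eq hΦ hlam, QuotientGroup.mk'_apply]
  · rw [← QuotientGroup.eq, QuotientGroup.mk_mul, hlam, QuotientGroup.mk_inv,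
      QuotientGroup.mk'_apply, eq_comm]

theorem songDual_eq_cosetDual {Φ : T ≃ G ⧸ MulAction.stabilizer G t₁}
    (hΦ : ∀ g : G, Φ (g • t₁) = QuotientGroup.mk g) (hlam : ∀ x, QuotientGroup.mk (lam x) = x) :
    songDual t₁ gt A Φ lam = cosetDual Φ A (QuotientGroup.mk gt) := by
  funext a
  rcases a with g | t <;>
    simp only [songDual, cosetDual, section_smul_eq hΦ hlam, hΦ, QuotientGroup.mk_inv, hlam]

end Song

/-- `G ⊔ T` with unit `1 ∈ G`, the song structure constants and the
song involution is a fusion ring, and this fusion ring does not depend on the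
particular choice of the section `λ`. -/
theorem song_is_fusion_ring {G T : Type*} [Group G] [Fintype G] [DecidableEq G]
    [Fintype T] [DecidableEq T] [MulAction G T]
    (t₁ : T) [(MulAction.stabilizer G t₁).Normal]
    (htrans : ∀ t : T, ∃ g : G, g • t₁ = t)
    (gt : G)
    (A : (G ⧸ MulAction.stabilizer G t₁) ≃* (G ⧸ MulAction.stabilizer G t₁))
    (hA2 : ∀ g : G, A (A (QuotientGroup.mk g)) = QuotientGroup.mk (gt⁻¹ * g * gt))
    (hAg : A (QuotientGroup.mk gt) = QuotientGroup.mk gt)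
    (Φ : T → G ⧸ MulAction.stabilizer G t₁)
    (hΦ : ∀ g : G, Φ (g • t₁) = QuotientGroup.mk g)
    (lam : (G ⧸ MulAction.stabilizer G t₁) → G)
    (hlam : ∀ x, QuotientGroup.mk (lam x) = x)
    (n : ℕ) :
    (∃ F : FusionData (G ⊕ T),
        F.one = Sum.inl 1 ∧
        F.dual = songDual t₁ gt A Φ lam ∧
        F.N = songN t₁ gt A Φ lam n) ∧
    (∀ lam' : (G ⧸ MulAction.stabilizer G t₁) → G,
        (∀ x, QuotientGroup.mk (lam' x) = x) →
        songN t₁ gt A Φ lam n = songN t₁ gt A Φ lam' n ∧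
        songDual t₁ gt A Φ lam = songDual t₁ gt A Φ lam') := by
  have hbij : Function.Bijective Φ := by
    refine ⟨fun s t hst => ?_, fun x => ?_⟩
    · obtain ⟨g, rfl⟩ := htrans s
      obtain ⟨h, rfl⟩ := htrans t
      rw [hΦ, hΦ, QuotientGroup.eq, MulAction.mem_stabilizer_iff, mul_smul,
        inv_smul_eq_iff] at hst
      exact hst.symm
    · obtain ⟨g, rfl⟩ := QuotientGroup.mk_surjective x
      exact ⟨g • t₁, hΦ g⟩
  obtain ⟨p, rfl⟩ : ∃ p : T ≃ G ⧸ MulAction.stabilizer G t₁, ⇑p = Φ :=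
    ⟨Equiv.ofBijective Φ hbij, rfl⟩
  refine ⟨⟨cosetFusionData (QuotientGroup.mk'_surjective _) p
    (QuotientGroup.mk_surjective.forall.2 hA2) hAg n, rfl, ?_, ?_⟩, fun lam' hlam' => ⟨?_, ?_⟩⟩
  · exact (songDual_eq_cosetDual hΦ hlam).symm
  · exact (songN_eq_cosetN hΦ hlam n).symm
  · rw [songN_eq_cosetN hΦ hlam, songN_eq_cosetN hΦ hlam']
  · rw [songDual_eq_cosetDual hΦ hlam, songDual_eq_cosetDual hΦ hlam']
end

section
/- In any extension of a finite group G by a finite set T, for all basis elements a, b ∈ G ⊔ T and all g ∈ G one has N_{ab}^g ∈ {0, 1}; moreover, for every t ∈ T and g ∈ G: N_{t t̄}^g = 1 if and only if g ∈ G^l_t, and N_{t̄ t}^g = 1 if and only if g ∈ G^r_t. -/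
/-- An extension of a finite group `G` by a finite set `T`: a fusion ring with
basis `G ⊔ T`, unit `1 ∈ G`, whose structure constants restrict to the group
multiplication on `G`. -/
structure GroupExt (G T : Type*) [Group G] [Fintype G] [DecidableEq G]
    [Fintype T] [DecidableEq T] extends FusionData (G ⊕ T) where
  one_def : one = Sum.inl 1
  mul_def : ∀ g h k : G, N (Sum.inl g) (Sum.inl h) (Sum.inl k) = if g * h = k then 1 else 0
  mul_t : ∀ (g h : G) (t : T), N (Sum.inl g) (Sum.inl h) (Sum.inr t) = 0

theorem FusionData.N_mul_one {B : Type*} [Fintype B] [DecidableEq B] (F : FusionData B)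
    (a b : B) : F.N a b F.one = if a = F.dual b then 1 else 0 := by
  rw [← F.dual_pair a (F.dual b), F.dual_dual]

/-- Cyclic symmetry of the structure constants. -/
theorem FusionData.N_cyclic {B : Type*} [Fintype B] [DecidableEq B] (F : FusionData B)
    (a b c : B) : F.N a b (F.dual c) = F.N b c (F.dual a) := by
  have dual_comm : ∀ f, a = F.dual f ↔ F.dual a = f := fun f =>
    ⟨fun h => by rw [h, F.dual_dual], fun h => by rw [← h, F.dual_dual]⟩
  simpa [F.N_mul_one, dual_comm] using F.assoc a b c F.one

/-- The duality is an anti-involution of the fusion ring. -/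
theorem FusionData.N_dual {B : Type*} [Fintype B] [DecidableEq B] (F : FusionData B)
    (a b c : B) : F.N a b c = F.N (F.dual b) (F.dual a) (F.dual c) := by
  have h := F.N_cyclic a b (F.dual c)
  rw [F.dual_dual] at h
  rw [h, F.frob]

theorem GroupExt.dual_inl {G T : Type*} [Group G] [Fintype G] [DecidableEq G]
    [Fintype T] [DecidableEq T] (E : GroupExt G T) (g : G) :
    E.dual (Sum.inl g) = Sum.inl g⁻¹ := by
  have h := E.N_mul_one (Sum.inl g⁻¹) (Sum.inl g)
  rw [E.one_def, E.mul_def] at h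
  by_contra hne
  simp [Ne.symm hne] at h

theorem GroupExt.sum_sq_N_mul_inl {G T : Type*} [Group G] [Fintype G] [DecidableEq G]
    [Fintype T] [DecidableEq T] (E : GroupExt G T) (x : G ⊕ T) (g : G) :
    ∑ e, E.N x (Sum.inl g) e * E.N x (Sum.inl g) e = 1 := by
  have hsymm : ∀ e, E.N e (Sum.inl g⁻¹) x = E.N x (Sum.inl g) e := fun e => by
    rw [E.frob, ← E.dual_inl, E.N_cyclic, E.dual_dual]
  have h := E.assoc x (Sum.inl g) (Sum.inl g⁻¹) x
  have hone : E.N x (Sum.inl 1) x = 1 := by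
    rw [← E.one_def, E.N_one_right, if_pos rfl]
  simpa [hsymm, Fintype.sum_sum_type, E.mul_def, E.mul_t, hone] using h

theorem GroupExt.N_mul_inl_le_one {G T : Type*} [Group G] [Fintype G] [DecidableEq G]
    [Fintype T] [DecidableEq T] (E : GroupExt G T) (x : G ⊕ T) (g : G) (e : G ⊕ T) :
    E.N x (Sum.inl g) e ≤ 1 := by
  have h := Finset.single_le_sum (f := fun e => E.N x (Sum.inl g) e * E.N x (Sum.inl g) e)
    (fun _ _ => Nat.zero_le _) (Finset.mem_univ e)
  rw [E.sum_sq_N_mul_inl] at h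
  exact (Nat.le_mul_self _).trans h

theorem GroupExt.N_inl_le_one {G T : Type*} [Group G] [Fintype G] [DecidableEq G]
    [Fintype T] [DecidableEq T] (E : GroupExt G T) (a b : G ⊕ T) (g : G) :
    E.N a b (Sum.inl g) ≤ 1 := by
  rw [E.frob]
  exact E.N_mul_inl_le_one _ g b

/-- In any extension of a finite group `G` by a finite set `T`,
`N_{ab}^g ∈ {0, 1}` for all basis elements `a, b` and all `g ∈ G`; moreover for
`t ∈ T` with dual `t̄`: `N_{t t̄}^g = 1 ↔ g ∈ G^l_t` and `N_{t̄ t}^g = 1 ↔ g ∈ G^r_t`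
(where `g ∈ G^l_t` iff `N_{gt}^t ≠ 0` and `g ∈ G^r_t` iff `N_{tg}^t ≠ 0`). -/
theorem group_coeffs_are_stabilizers {G T : Type*} [Group G] [Fintype G] [DecidableEq G]
    [Fintype T] [DecidableEq T] [Nonempty T] (E : GroupExt G T) :
    (∀ (a b : G ⊕ T) (g : G), E.N a b (Sum.inl g) ≤ 1) ∧
    (∀ t tb : T, E.dual (Sum.inr t) = Sum.inr tb →
      ∀ g : G,
        (E.N (Sum.inr t) (Sum.inr tb) (Sum.inl g) = 1 ↔
          E.N (Sum.inl g) (Sum.inr t) (Sum.inr t) ≠ 0) ∧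
        (E.N (Sum.inr tb) (Sum.inr t) (Sum.inl g) = 1 ↔
          E.N (Sum.inr t) (Sum.inl g) (Sum.inr t) ≠ 0)) := by
  refine ⟨E.N_inl_le_one, fun t tb ht g => ?_⟩
  have htb : E.dual (Sum.inr tb) = Sum.inr t := by rw [← ht, E.dual_dual]
  have hl : E.N (Sum.inl g) (Sum.inr t) (Sum.inr t) =
      E.N (Sum.inr t) (Sum.inr tb) (Sum.inl g) := by
    rw [← htb, E.N_cyclic, E.N_dual (E.dual (Sum.inr tb)), htb, ht, E.dual_dual]
  have hr : E.N (Sum.inr t) (Sum.inl g) (Sum.inr t) =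
      E.N (Sum.inr tb) (Sum.inr t) (Sum.inl g) := by
    rw [E.frob (Sum.inr tb), htb]
  have hl_le := E.N_inl_le_one (Sum.inr t) (Sum.inr tb) g
  have hr_le := E.N_inl_le_one (Sum.inr tb) (Sum.inr t) g
  rw [hl, hr]
  omega
end

section
/- Let G be a finite group and T = {t} a one-element set. Then for each k ∈ ℕ there exists exactly one extension R of G by T with N_{tt}^t = k, and its fusion rules are: g × t = t × g = t for all g ∈ G, and t × t = ∑_{g∈G} g + k t (i.e. N_{tt}^g = 1 for every g ∈ G). Moreover any extension R of G by a one-element set T is commutative if and only if G is commutative. -/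
/-- The structure constants `g × t = t × g = t` and `t × t = ∑ g + k t` on `G ⊔ {t}`. -/
def nearGroupN {G T : Type*} [Group G] [DecidableEq G] (k : ℕ) :
    G ⊕ T → G ⊕ T → G ⊕ T → ℕ
  | .inl g, .inl h, .inl l => if g * h = l then 1 else 0
  | .inl _, .inl _, .inr _ => 0
  | .inl _, .inr _, .inl _ => 0
  | .inl _, .inr _, .inr _ => 1
  | .inr _, .inl _, .inl _ => 0
  | .inr _, .inl _, .inr _ => 1
  | .inr _, .inr _, .inl _ => 1
  | .inr _, .inr _, .inr _ => k

/-- The near-group fusion ring of `G` with multiplicity `k`, as an extension of `G`. -/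
def nearGroup (G T : Type*) [Group G] [Fintype G] [DecidableEq G]
    [Fintype T] [DecidableEq T] [Unique T] (k : ℕ) : GroupExt G T where
  one := .inl 1
  dual := Sum.map (·⁻¹) id
  N := nearGroupN k
  dual_dual := by rintro (g | t) <;> simp
  N_one_left := by
    rintro (g | s) (h | t) <;> simp [nearGroupN, eq_iff_true_of_subsingleton]
  N_one_right := by
    rintro (g | s) (h | t) <;> simp [nearGroupN, eq_iff_true_of_subsingleton]
  assoc := by
    have card_left (a d : G) : ({x | a * x = d} : Finset G).card = 1 := by
      simp [← eq_inv_mul_iff_mul_eq, Finset.filter_eq']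
    have card_right (a d : G) : ({x | x * a = d} : Finset G).card = 1 := by
      simp [← eq_mul_inv_iff_mul_eq, Finset.filter_eq']
    rintro (a | a) (b | b) (c | c) (d | d)
    · simp [nearGroupN, Fintype.sum_sum_type, -mul_ite, ite_mul, mul_assoc]
    all_goals simp [nearGroupN, Fintype.sum_sum_type, card_left, card_right]
  dual_pair := by
    rintro (g | s) (h | t) <;>
      simp [nearGroupN, eq_iff_true_of_subsingleton, mul_inv_eq_one]
  frob := by
    rintro (a | a) (b | b) (c | c) <;> simp [nearGroupN, inv_mul_eq_iff_eq_mul]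
    simp only [eq_comm]
  one_def := rfl
  mul_def _ _ _ := rfl
  mul_t _ _ _ := rfl

namespace GroupExt

variable {G T : Type*} [Group G] [Fintype G] [DecidableEq G] [Fintype T] [DecidableEq T]

theorem dual_inl_s11 (E : GroupExt G T) (g : G) : E.dual (.inl g) = .inl g⁻¹ := by
  have h := E.dual_pair (.inl g⁻¹) (E.dual (.inl g))
  rw [E.dual_dual, E.one_def, E.mul_def] at h
  by_contra hne
  simp [Ne.symm hne] at h

theorem dual_inr [Subsingleton T] (E : GroupExt G T) (t : T) :
    E.dual (.inr t) = .inr t := by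
  rcases h : E.dual (.inr t) with g | s
  · have h' := E.dual_dual (.inr t)
    rw [h, E.dual_inl_s11] at h'
    cases h'
  · rw [Subsingleton.elim s t]

theorem N_inl_inr_inl (E : GroupExt G T) (g h : G) (t : T) :
    E.N (.inl g) (.inr t) (.inl h) = 0 := by
  rw [E.frob, E.dual_inl_s11, E.mul_t]

theorem N_inl_inr_inr [Unique T] (E : GroupExt G T) (g : G) (s t : T) :
    E.N (.inl g) (.inr s) (.inr t) = 1 := by
  obtain rfl := Subsingleton.elim s default
  obtain rfl := Subsingleton.elim t default
  have h := E.assoc (.inl g⁻¹) (.inl g) (.inr default) (.inr default)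
  have h1 := E.N_one_left (.inr default) (.inr default)
  rw [E.one_def] at h1
  simp [Fintype.sum_sum_type, E.mul_def, E.mul_t, E.N_inl_inr_inl, h1] at h
  exact Nat.eq_one_of_mul_eq_one_right h.symm

theorem N_inr_inl_inl [Unique T] (E : GroupExt G T) (g h : G) (t : T) :
    E.N (.inr t) (.inl g) (.inl h) = 0 := by
  have pair (l : G) : E.N (.inr t) (.inl l) (.inl 1) = 0 := by
    have := E.dual_pair (.inr t) (.inl l⁻¹)
    simpa [E.dual_inl_s11, E.one_def] using this
  have key := E.assoc (.inr t) (.inl g) (.inl h⁻¹) (.inl 1)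
  simp [Fintype.sum_sum_type, E.mul_def, E.mul_t, pair, mul_inv_eq_one] at key
  exact key.1

theorem N_inr_inl_inr [Unique T] (E : GroupExt G T) (g : G) (s t : T) :
    E.N (.inr s) (.inl g) (.inr t) = 1 := by
  obtain rfl := Subsingleton.elim s default
  obtain rfl := Subsingleton.elim t default
  have h := E.assoc (.inr default) (.inl g) (.inl g⁻¹) (.inr default)
  have h1 := E.N_one_right (.inr default) (.inr default)
  rw [E.one_def] at h1
  simp [Fintype.sum_sum_type, E.mul_def, E.mul_t, E.N_inr_inl_inl, h1] at h
  exact h.1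

theorem N_eq_nearGroupN [Unique T] (E : GroupExt G T) :
    E.N = nearGroupN (E.N (.inr default) (.inr default) (.inr default)) := by
  funext a b c
  rcases a with a | a <;> rcases b with b | b <;> rcases c with c | c
  · exact E.mul_def a b c
  · exact E.mul_t a b c
  · exact E.N_inl_inr_inl a c b
  · exact E.N_inl_inr_inr a b c
  · exact E.N_inr_inl_inl b c a
  · exact E.N_inr_inl_inr b a c
  · rw [E.frob, E.dual_inr, E.N_inr_inl_inr]; rfl
  · simp only [Subsingleton.elim _ (default : T), nearGroupN]

theorem dual_eq [Unique T] (E : GroupExt G T) : E.dual = Sum.map (·⁻¹) id := by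
  funext a
  rcases a with g | t
  · exact E.dual_inl_s11 g
  · exact E.dual_inr t

end GroupExt

theorem nearGroupN_comm_iff {G T : Type*} [Group G] [DecidableEq G] (k : ℕ) :
    (∀ a b c : G ⊕ T, nearGroupN k a b c = nearGroupN k b a c) ↔
      ∀ g h : G, g * h = h * g := by
  refine ⟨fun H g h => ?_, fun H => ?_⟩
  · have := H (.inl g) (.inl h) (.inl (h * g))
    by_contra hne
    simp [nearGroupN, hne] at this
  · rintro (a | a) (b | b) (c | c)
    · simp [nearGroupN, H a]
    all_goals rfl

/-- If `|T| = 1` then for each `k ∈ ℕ` there is exactly one extension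
of `G` by `T` with `N_{tt}^t = k`; its fusion rules are `g × t = t × g = t` and
`t × t = ∑_{g∈G} g + k t`.  Moreover any extension of `G` by a one-element set is
commutative iff `G` is commutative. -/
theorem one_particle_extension {G T : Type*} [Group G] [Fintype G] [DecidableEq G]
    [Fintype T] [DecidableEq T] [Nonempty T]
    (hT : Fintype.card T = 1) :
    (∀ k : ℕ,
      (∃ E : GroupExt G T, ∀ t : T, E.N (Sum.inr t) (Sum.inr t) (Sum.inr t) = k) ∧
      (∀ E E' : GroupExt G T,
        (∀ t : T, E.N (Sum.inr t) (Sum.inr t) (Sum.inr t) = k) →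
        (∀ t : T, E'.N (Sum.inr t) (Sum.inr t) (Sum.inr t) = k) →
        E.N = E'.N ∧ E.dual = E'.dual) ∧
      (∀ E : GroupExt G T,
        (∀ t : T, E.N (Sum.inr t) (Sum.inr t) (Sum.inr t) = k) →
        ∀ (g : G) (t : T),
          E.N (Sum.inl g) (Sum.inr t) (Sum.inr t) = 1 ∧
          (∀ h : G, E.N (Sum.inl g) (Sum.inr t) (Sum.inl h) = 0) ∧
          E.N (Sum.inr t) (Sum.inl g) (Sum.inr t) = 1 ∧
          (∀ h : G, E.N (Sum.inr t) (Sum.inl g) (Sum.inl h) = 0) ∧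
          E.N (Sum.inr t) (Sum.inr t) (Sum.inl g) = 1)) ∧
    (∀ E : GroupExt G T,
      (∀ a b c : G ⊕ T, E.N a b c = E.N b a c) ↔ ∀ g h : G, g * h = h * g) := by
  obtain ⟨_⟩ := Fintype.card_eq_one_iff_nonempty_unique.mp hT
  refine ⟨fun k => ⟨⟨nearGroup G T k, fun _ => rfl⟩, fun E E' hE hE' => ⟨?_, ?_⟩,
    fun E _ g t => ⟨E.N_inl_inr_inr g t t, fun h => E.N_inl_inr_inl g h t,
      E.N_inr_inl_inr g t t, fun h => E.N_inr_inl_inl g h t, ?_⟩⟩, fun E => ?_⟩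
  · rw [E.N_eq_nearGroupN, E'.N_eq_nearGroupN, hE, hE']
  · rw [E.dual_eq, E'.dual_eq]
  · rw [E.N_eq_nearGroupN]; rfl
  · rw [E.N_eq_nearGroupN]
    exact nearGroupN_comm_iff _
end
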